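/- Let d be an odd positive integer and let ε : {0,…,d−1} → {−1,1} be any sign pattern. Then the set F_d(ε) of coefficient vectors (a_0,…,a_{d−1}) ∈ ℝ^d such that the monic polynomial Q = x^d + a_{d−1}x^{d−1} + ⋯ + a_0 has sign pattern ε and has exactly one real root, which is simple, is nonempty and contractible. -/

import Mathlib

open Polynomial

/-- The monic polynomial `x^d + a_{d-1} x^{d-1} + ⋯ + a_1 x + a_0`
associated to a coefficient vector `a ∈ ℝ^d`. -/
noncomputable def Qpoly (d : ℕ) (a : Fin d → ℝ) : Polynomial ℝ :=
  X ^ d + ∑ j : Fin d, C (a j) * X ^ (j : ℕ)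

open Filter Topology

theorem Qpoly_monic (d : ℕ) (a : Fin d → ℝ) : (Qpoly d a).Monic :=
  monic_X_pow_add (degree_sum_fin_lt a)

theorem natDegree_Qpoly (d : ℕ) (a : Fin d → ℝ) : (Qpoly d a).natDegree = d := by
  have h : (Qpoly d a).degree = d := by
    rw [Qpoly, degree_add_eq_left_of_degree_lt, degree_X_pow]
    rw [degree_X_pow]
    exact degree_sum_fin_lt a
  exact natDegree_eq_of_degree_eq_some h

theorem eval_Qpoly (d : ℕ) (a : Fin d → ℝ) (x : ℝ) :
    (Qpoly d a).eval x = x ^ d + ∑ j : Fin d, a j * x ^ (j : ℕ) := by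
  simp [Qpoly, eval_finsetSum]

theorem eval_zero_Qpoly {d : ℕ} (hd : 0 < d) (a : Fin d → ℝ) :
    (Qpoly d a).eval 0 = a ⟨0, hd⟩ := by
  rw [eval_Qpoly, Finset.sum_eq_single ⟨0, hd⟩]
  · simp [hd.ne']
  · intro j _ hj
    have : (j : ℕ) ≠ 0 := fun h => hj (Fin.ext h)
    simp [this]
  · simp

theorem Qpoly_affine {d : ℕ} (a b : Fin d → ℝ) {s t : ℝ} (hst : s + t = 1) :
    Qpoly d (s • a + t • b) = C s * Qpoly d a + C t * Qpoly d b := by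
  have h : (C s + C t : ℝ[X]) = 1 := by rw [← C_add, hst, C_1]
  have hX : (X ^ d : ℝ[X]) = C s * X ^ d + C t * X ^ d := by rw [← add_mul, h, one_mul]
  simp only [Qpoly, Pi.add_apply, Pi.smul_apply, smul_eq_mul, C_add, C_mul, add_mul,
    Finset.sum_add_distrib, mul_assoc, ← Finset.mul_sum]
  nth_rewrite 1 [hX]
  ring

/-- The action of the substitution `x ↦ x / t` on coefficient vectors of monic polynomials. -/
def scaleCoeff {d : ℕ} (t : ℝ) (a : Fin d → ℝ) : Fin d → ℝ :=
  fun j => t ^ (d - (j : ℕ)) * a j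

theorem scaleCoeff_scaleCoeff {d : ℕ} (s t : ℝ) (a : Fin d → ℝ) :
    scaleCoeff s (scaleCoeff t a) = scaleCoeff (s * t) a := by
  funext j
  simp only [scaleCoeff, mul_pow, mul_assoc]

theorem scaleCoeff_one {d : ℕ} (a : Fin d → ℝ) : scaleCoeff 1 a = a := by
  funext j
  simp [scaleCoeff]

theorem Qpoly_scaleCoeff_comp {d : ℕ} (t : ℝ) (a : Fin d → ℝ) :
    (Qpoly d (scaleCoeff t a)).comp (C t * X) = C (t ^ d) * Qpoly d a := by
  simp only [Qpoly, scaleCoeff, add_comp, pow_comp, X_comp, Polynomial.sum_comp, mul_comp, C_comp,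
    mul_add, mul_pow, Finset.mul_sum, C_pow]
  congr 1
  refine Finset.sum_congr rfl fun j _ => ?_
  rw [C_mul, C_pow, ← pow_sub_mul_pow (C t) j.2.le]
  ring

theorem eval_Qpoly_scaleCoeff {d : ℕ} (t x : ℝ) (a : Fin d → ℝ) :
    (Qpoly d (scaleCoeff t a)).eval (t * x) = t ^ d * (Qpoly d a).eval x := by
  simpa using congrArg (eval x) (Qpoly_scaleCoeff_comp t a)

theorem eval_derivative_Qpoly_scaleCoeff {d : ℕ} (t x : ℝ) (a : Fin d → ℝ) :
    t * (derivative (Qpoly d (scaleCoeff t a))).eval (t * x) =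
      t ^ d * (derivative (Qpoly d a)).eval x := by
  simpa [derivative_comp, derivative_C_mul, -map_pow] using
    congrArg (fun p => (derivative p).eval x) (Qpoly_scaleCoeff_comp t a)

theorem Qpoly_neg_comp {d : ℕ} (hd : Odd d) (a : Fin d → ℝ) :
    Qpoly d (scaleCoeff (-1) a) = -(Qpoly d a).comp (-X) := by
  have h := congrArg (fun p => p.comp (-X)) (Qpoly_scaleCoeff_comp (-1) a)
  simpa [comp_assoc, hd.neg_one_pow] using h

theorem tendsto_eval_Qpoly_atTop {d : ℕ} (hd : 0 < d) (a : Fin d → ℝ) :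
    Tendsto (fun x => (Qpoly d a).eval x) atTop atTop := by
  refine tendsto_atTop_of_leadingCoeff_nonneg _ ?_ ?_
  · rw [← natDegree_pos_iff_degree_pos, natDegree_Qpoly]
    exact hd
  · rw [(Qpoly_monic d a).leadingCoeff]
    exact zero_le_one

theorem tendsto_eval_Qpoly_atBot {d : ℕ} (hd : Odd d) (a : Fin d → ℝ) :
    Tendsto (fun x => (Qpoly d a).eval x) atBot atBot := by
  have h := (tendsto_eval_Qpoly_atTop hd.pos (scaleCoeff (-1) a)).comp tendsto_neg_atBot_atTop
  rw [← tendsto_neg_atTop_iff]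
  simpa [Function.comp_def, Qpoly_neg_comp hd] using h

theorem eventually_derivative_Qpoly_pos_atTop {d : ℕ} (hd : 0 < d) (a : Fin d → ℝ) :
    ∀ᶠ x in atTop, 0 < (derivative (Qpoly d a)).eval x := by
  have hc : (derivative (Qpoly d a)).leadingCoeff = d := by
    simp [leadingCoeff_derivative, (Qpoly_monic d a).leadingCoeff, natDegree_Qpoly]
  have hd' : (0 : ℝ) < d := by exact_mod_cast hd
  have h0 : derivative (Qpoly d a) ≠ 0 := by
    rw [← leadingCoeff_ne_zero, hc]
    exact hd'.ne'
  have h : Tendsto (fun x => (X * derivative (Qpoly d a)).eval x) atTop atTop := by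
    refine tendsto_atTop_of_leadingCoeff_nonneg _ ?_ ?_
    · rw [← natDegree_pos_iff_degree_pos, natDegree_X_mul h0]
      exact Nat.succ_pos _
    · rw [leadingCoeff_mul, hc, leadingCoeff_X, one_mul]
      exact hd'.le
  filter_upwards [h.eventually_gt_atTop 0, eventually_gt_atTop 0] with x hx hx0
  rw [eval_mul, eval_X] at hx
  exact (mul_pos_iff_of_pos_left hx0).1 hx

theorem eventually_derivative_Qpoly_pos_atBot {d : ℕ} (hd : Odd d) (a : Fin d → ℝ) :
    ∀ᶠ x in atBot, 0 < (derivative (Qpoly d a)).eval x := by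
  have h := tendsto_neg_atBot_atTop.eventually
    (eventually_derivative_Qpoly_pos_atTop hd.pos (scaleCoeff (-1) a))
  filter_upwards [h] with x hx
  simpa [Qpoly_neg_comp hd, derivative_comp] using hx

/-- `p` is negative to the left of `r`, positive to the right, and has a simple root at `r`. -/
structure IsSimpleCrossing (p : ℝ[X]) (r : ℝ) : Prop where
  neg : ∀ x < r, p.eval x < 0
  pos : ∀ x, r < x → 0 < p.eval x
  root : p.eval r = 0
  derivative_pos : 0 < (derivative p).eval r

namespace IsSimpleCrossing

theorem eq_of_root {p : ℝ[X]} {r x : ℝ} (h : IsSimpleCrossing p r) (hx : p.eval x = 0) :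
    x = r := by
  rcases lt_trichotomy x r with hr | hr | hr
  · exact absurd hx (h.neg x hr).ne
  · exact hr
  · exact absurd hx (h.pos x hr).ne'

theorem pos_iff {p : ℝ[X]} {r x : ℝ} (h : IsSimpleCrossing p r) : 0 < p.eval x ↔ r < x := by
  refine ⟨fun hx => ?_, h.pos x⟩
  by_contra! hr
  rcases hr.lt_or_eq with hr | rfl
  · exact hx.not_gt (h.neg x hr)
  · exact hx.ne' h.root

theorem neg_iff {p : ℝ[X]} {r x : ℝ} (h : IsSimpleCrossing p r) : p.eval x < 0 ↔ x < r := by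
  refine ⟨fun hx => ?_, h.neg x⟩
  by_contra! hr
  rcases hr.lt_or_eq with hr | rfl
  · exact hx.not_gt (h.pos x hr)
  · exact hx.ne h.root

theorem combo {p q : ℝ[X]} {r s t : ℝ} (hp : IsSimpleCrossing p r) (hq : IsSimpleCrossing q r)
    (hs : 0 ≤ s) (ht : 0 ≤ t) (hst : s + t = 1) : IsSimpleCrossing (C s * p + C t * q) r where
  neg x hx := by
    have h1 := hp.neg x hx
    have h2 := hq.neg x hx
    simpa using convex_Iio (0 : ℝ) h1 h2 hs ht hst
  pos x hx := by
    have h1 := hp.pos x hx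
    have h2 := hq.pos x hx
    simpa using convex_Ioi (0 : ℝ) h1 h2 hs ht hst
  root := by simp [hp.root, hq.root]
  derivative_pos := by
    simpa using convex_Ioi (0 : ℝ) hp.derivative_pos hq.derivative_pos hs ht hst

theorem scale {d : ℕ} {a : Fin d → ℝ} {r t : ℝ} (h : IsSimpleCrossing (Qpoly d a) r)
    (ht : 0 < t) : IsSimpleCrossing (Qpoly d (scaleCoeff t a)) (t * r) where
  neg x hx := by
    have hx' : x / t < r := by rwa [div_lt_iff₀' ht]
    rw [← mul_div_cancel₀ x ht.ne', eval_Qpoly_scaleCoeff]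
    exact mul_neg_of_pos_of_neg (pow_pos ht d) (h.neg _ hx')
  pos x hx := by
    have hx' : r < x / t := by rwa [lt_div_iff₀' ht]
    rw [← mul_div_cancel₀ x ht.ne', eval_Qpoly_scaleCoeff]
    exact mul_pos (pow_pos ht d) (h.pos _ hx')
  root := by rw [eval_Qpoly_scaleCoeff, h.root, mul_zero]
  derivative_pos := by
    rw [← mul_pos_iff_of_pos_left ht, eval_derivative_Qpoly_scaleCoeff]
    exact mul_pos (pow_pos ht d) h.derivative_pos

end IsSimpleCrossing

theorem exists_root_of_neg_of_pos (p : ℝ[X]) {x y : ℝ} (hxy : x ≤ y) (hx : p.eval x < 0)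
    (hy : 0 < p.eval y) : ∃ z, x ≤ z ∧ z ≤ y ∧ p.eval z = 0 := by
  obtain ⟨z, hz, h⟩ := intermediate_value_Icc hxy p.continuous.continuousOn ⟨hx.le, hy.le⟩
  exact ⟨z, hz.1, hz.2, h⟩

theorem isSimpleCrossing_of_unique_root {d : ℕ} (hd : Odd d) (a : Fin d → ℝ) {r : ℝ}
    (hr : (Qpoly d a).eval r = 0) (hr' : (derivative (Qpoly d a)).eval r ≠ 0)
    (huniq : ∀ x, (Qpoly d a).eval x = 0 → x = r) : IsSimpleCrossing (Qpoly d a) r := by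
  have hneg : ∀ x < r, (Qpoly d a).eval x < 0 := by
    intro x hx
    by_contra! h
    have h' := h.lt_of_ne fun h0 => hx.ne (huniq x h0.symm)
    obtain ⟨y, hy, hyx⟩ := (((tendsto_eval_Qpoly_atBot hd a).eventually_lt_atBot 0).and
      (eventually_le_atBot x)).exists
    obtain ⟨z, -, hz, hz0⟩ := exists_root_of_neg_of_pos _ hyx hy h'
    exact (hz.trans_lt hx).ne (huniq z hz0)
  have hpos : ∀ x, r < x → 0 < (Qpoly d a).eval x := by
    intro x hx
    by_contra! h
    have h' := h.lt_of_ne fun h0 => hx.ne' (huniq x h0)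
    obtain ⟨y, hy, hyx⟩ := (((tendsto_eval_Qpoly_atTop hd.pos a).eventually_gt_atTop 0).and
      (eventually_ge_atTop x)).exists
    obtain ⟨z, hz, -, hz0⟩ := exists_root_of_neg_of_pos _ hyx h' hy
    exact (hx.trans_le hz).ne' (huniq z hz0)
  refine ⟨hneg, hpos, hr, lt_of_le_of_ne ?_ hr'.symm⟩
  refine ge_of_tendsto ((Qpoly d a).hasDerivAt r).tendsto_slope ?_
  filter_upwards [self_mem_nhdsWithin] with x hx
  rw [slope_def_field, hr, sub_zero]
  rcases lt_or_gt_of_ne hx with h | h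
  · exact div_nonneg_of_nonpos (hneg x h).le (sub_neg.2 h).le
  · exact div_nonneg (hpos x h).le (sub_pos.2 h).le

theorem exists_coeff_isSimpleCrossing {d : ℕ} (hd : Odd d) (ε : Fin d → ℝ)
    (hε : ∀ j, ε j = 1 ∨ ε j = -1) :
    ∃ a : Fin d → ℝ, (∀ j, 0 < ε j * a j) ∧ ∃ r, IsSimpleCrossing (Qpoly d a) r := by
  obtain ⟨B₁, hB₁⟩ := eventually_atTop.1 (eventually_derivative_Qpoly_pos_atTop hd.pos ε)
  obtain ⟨B₂, hB₂⟩ := eventually_atBot.1 (eventually_derivative_Qpoly_pos_atBot hd ε)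
  set u := min B₂ 0
  set v := max B₁ 0
  have huv : u ≤ v := (min_le_right _ _).trans (le_max_right _ _)
  obtain ⟨M, hM⟩ := (isCompact_Icc (a := u) (b := v)).exists_bound_of_continuousOn
    (Qpoly d ε).continuous.continuousOn
  have hM0 : 0 ≤ M := (norm_nonneg _).trans (hM u ⟨le_rfl, huv⟩)
  set i₀ : Fin d := ⟨0, hd.pos⟩
  set a : Fin d → ℝ := ε + Pi.single i₀ (ε i₀ * (M + 1)) with ha
  have hQ : Qpoly d a = Qpoly d ε + C (ε i₀ * (M + 1)) := by
    simp only [Qpoly, ha, Pi.add_apply, C_add, add_mul, Finset.sum_add_distrib, add_assoc]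
    congr 2
    rw [Finset.sum_eq_single i₀]
    · simp [i₀]
    · intro j _ hj
      simp [Pi.single_eq_of_ne hj]
    · simp
  have hsq : ∀ j, ε j * ε j = 1 := fun j => by rcases hε j with h | h <;> simp [h]
  have hD : derivative (Qpoly d a) = derivative (Qpoly d ε) := by simp [hQ]
  have hmono₁ : StrictMonoOn (fun x => (Qpoly d a).eval x) (Set.Ici v) := by
    refine strictMonoOn_of_deriv_pos (convex_Ici v) (Qpoly d a).continuous.continuousOn ?_
    intro x hx
    rw [interior_Ici] at hx
    rw [Polynomial.deriv, hD]
    exact hB₁ x ((le_max_left _ _).trans hx.le)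
  have hmono₂ : StrictMonoOn (fun x => (Qpoly d a).eval x) (Set.Iic u) := by
    refine strictMonoOn_of_deriv_pos (convex_Iic u) (Qpoly d a).continuous.continuousOn ?_
    intro x hx
    rw [interior_Iic] at hx
    rw [Polynomial.deriv, hD]
    exact hB₂ x (hx.le.trans (min_le_left _ _))
  have hmid : ∀ x ∈ Set.Icc u v, 0 < ε i₀ * (Qpoly d a).eval x := by
    intro x hx
    have h := abs_le.1 (hM x hx)
    rw [hQ, eval_add, eval_C, mul_add, ← mul_assoc, hsq]
    rcases hε i₀ with h1 | h1 <;> rw [h1] <;> linarith [h.1, h.2]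
  refine ⟨a, fun j => ?_, ?_⟩
  · by_cases hj : j = i₀
    · subst hj
      rw [ha, Pi.add_apply, Pi.single_eq_same, mul_add, ← mul_assoc, hsq]
      linarith
    · rw [ha, Pi.add_apply, Pi.single_eq_of_ne hj, add_zero, hsq]
      exact one_pos
  obtain ⟨y, hy, hyu⟩ := (((tendsto_eval_Qpoly_atBot hd a).eventually_lt_atBot 0).and
    (eventually_le_atBot 0)).exists
  obtain ⟨z, hz, hzv⟩ := (((tendsto_eval_Qpoly_atTop hd.pos a).eventually_gt_atTop 0).and
    (eventually_ge_atTop 0)).exists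
  obtain ⟨r, -, -, hr⟩ := exists_root_of_neg_of_pos _ (hyu.trans hzv) hy hz
  have hout : ∀ x, (Qpoly d a).eval x = 0 → x < u ∨ v < x := by
    intro x hx
    by_contra! h
    have := hmid x h
    rw [hx, mul_zero] at this
    exact this.false
  refine ⟨r, isSimpleCrossing_of_unique_root hd a hr ?_ ?_⟩
  · rw [hD]
    rcases hout r hr with h | h
    · exact (hB₂ r (h.le.trans (min_le_left _ _))).ne'
    · exact (hB₁ r ((le_max_left _ _).trans h.le)).ne'
  · have hleft : ∀ x, (Qpoly d a).eval x = 0 → x < u → 0 < (Qpoly d a).eval u := fun x hx h => by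
      simpa [hx] using hmono₂ (Set.mem_Iic.2 h.le) Set.self_mem_Iic h
    have hright : ∀ x, (Qpoly d a).eval x = 0 → v < x → (Qpoly d a).eval v < 0 := fun x hx h => by
      simpa [hx] using hmono₁ Set.self_mem_Ici (Set.mem_Ici.2 h.le) h
    have hsame : 0 < (Qpoly d a).eval u → (Qpoly d a).eval v < 0 → False := fun h1 h2 => by
      have h3 := hmid u ⟨le_rfl, huv⟩
      have h4 := hmid v ⟨huv, le_rfl⟩
      rcases hε i₀ with h | h <;> rw [h] at h3 h4 <;> linarith
    intro x hx
    rcases hout r hr with h | h <;> rcases hout x hx with h' | h'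
    · exact hmono₂.injOn h'.le h.le (hx.trans hr.symm)
    · exact (hsame (hleft r hr h) (hright x hx h')).elim
    · exact (hsame (hleft x hx h') (hright r hr h)).elim
    · exact hmono₁.injOn h'.le h.le (hx.trans hr.symm)

theorem continuous_root {d : ℕ} {S : Set (Fin d → ℝ)} (ρ : S → ℝ)
    (hρ : ∀ a : S, IsSimpleCrossing (Qpoly d a) (ρ a)) : Continuous ρ := by
  have hc : ∀ c : ℝ, Continuous fun a : S => (Qpoly d a).eval c := fun c => by
    simp only [eval_Qpoly]
    refine continuous_const.add (continuous_finsetSum _ fun j _ => ?_)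
    exact ((continuous_apply j).comp continuous_subtype_val).mul continuous_const
  refine OrderTopology.continuous_iff.2 fun c => ⟨?_, ?_⟩
  · have : ρ ⁻¹' Set.Ioi c = {a : S | (Qpoly d a).eval c < 0} := by
      ext a
      exact (hρ a).neg_iff.symm
    rw [this]
    exact isOpen_lt (hc c) continuous_const
  · have : ρ ⁻¹' Set.Iio c = {a : S | 0 < (Qpoly d a).eval c} := by
      ext a
      exact (hρ a).pos_iff.symm
    rw [this]
    exact isOpen_lt continuous_const (hc c)

theorem continuous_scaleCoeff {d : ℕ} :
    Continuous fun q : ℝ × (Fin d → ℝ) => scaleCoeff q.1 q.2 := by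
  unfold scaleCoeff
  fun_prop

theorem scaleCoeff_sign {d : ℕ} {ε a : Fin d → ℝ} {t : ℝ} (ht : 0 < t)
    (h : ∀ j, 0 < ε j * a j) (j : Fin d) : 0 < ε j * scaleCoeff t a j := by
  rw [scaleCoeff, mul_left_comm]
  exact mul_pos (pow_pos ht _) (h j)

theorem convex_isSimpleCrossing {d : ℕ} (ε : Fin d → ℝ) (r : ℝ) :
    Convex ℝ {a : Fin d → ℝ | (∀ j, 0 < ε j * a j) ∧ IsSimpleCrossing (Qpoly d a) r} := by
  rintro a ⟨ha, ha'⟩ b ⟨hb, hb'⟩ s t hs ht hst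
  refine ⟨fun j => ?_, ?_⟩
  · have h := convex_Ioi (0 : ℝ) (ha j) (hb j) hs ht hst
    simp only [smul_eq_mul, Set.mem_Ioi] at h
    simp only [Pi.add_apply, Pi.smul_apply, smul_eq_mul]
    linarith
  · rw [Qpoly_affine a b hst]
    exact ha'.combo hb' hs ht hst

theorem contractibleSpace_isSimpleCrossing {d : ℕ} (hd : Odd d) (ε : Fin d → ℝ)
    (hε : ∀ j, ε j = 1 ∨ ε j = -1) :
    ContractibleSpace
      {a : Fin d → ℝ | (∀ j, 0 < ε j * a j) ∧ ∃ r, IsSimpleCrossing (Qpoly d a) r} := by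
  set F := {a : Fin d → ℝ | (∀ j, 0 < ε j * a j) ∧ ∃ r, IsSimpleCrossing (Qpoly d a) r}
  set s : ℝ := -ε ⟨0, hd.pos⟩ with hs
  have hss : s * s = 1 := by rcases hε ⟨0, hd.pos⟩ with h | h <;> simp [hs, h]
  set K := {a : Fin d → ℝ | (∀ j, 0 < ε j * a j) ∧ IsSimpleCrossing (Qpoly d a) s}
  choose ρ hρ using fun a : F => a.2.2
  have hpos : ∀ a : F, 0 < s * ρ a := by
    intro a
    have h0 := a.2.1 ⟨0, hd.pos⟩
    rw [← eval_zero_Qpoly hd.pos a.1] at h0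
    rcases hε ⟨0, hd.pos⟩ with h | h
    · rw [h, one_mul, (hρ a).pos_iff] at h0
      rw [hs, h]
      linarith
    · rw [h, neg_one_mul, neg_pos, (hρ a).neg_iff] at h0
      rw [hs, h]
      linarith
  have hρc : Continuous ρ := continuous_root ρ hρ
  have hnorm : ∀ a : F, scaleCoeff (s * ρ a)⁻¹ a.1 ∈ K := by
    intro a
    refine ⟨scaleCoeff_sign (inv_pos.2 (hpos a)) a.2.1, ?_⟩
    have h := (hρ a).scale (inv_pos.2 (hpos a))
    have hr : (s * ρ a)⁻¹ * ρ a = s := by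
      rw [inv_mul_eq_iff_eq_mul₀ (hpos a).ne', mul_right_comm, hss, one_mul]
    rwa [hr] at h
  have hmem : ∀ q : Set.Ioi (0 : ℝ) × K, scaleCoeff q.1.1 q.2.1 ∈ F := fun q =>
    ⟨scaleCoeff_sign q.1.2 q.2.2.1, _, q.2.2.2.scale q.1.2⟩
  have hroot : ∀ q : Set.Ioi (0 : ℝ) × K, s * ρ ⟨_, hmem q⟩ = q.1 := by
    intro q
    have h : q.1.1 * s = ρ ⟨_, hmem q⟩ := (hρ ⟨_, hmem q⟩).eq_of_root (q.2.2.2.scale q.1.2).root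
    rw [← h, mul_left_comm, hss, mul_one]
  let e : F ≃ₜ Set.Ioi (0 : ℝ) × K :=
    { toFun a := (⟨s * ρ a, hpos a⟩, ⟨_, hnorm a⟩)
      invFun q := ⟨_, hmem q⟩
      left_inv a := by
        refine Subtype.ext ?_
        simp only [scaleCoeff_scaleCoeff]
        rw [mul_inv_cancel₀ (hpos a).ne', scaleCoeff_one]
      right_inv q := by
        refine Prod.ext (Subtype.ext (hroot q)) (Subtype.ext ?_)
        simp only [hroot q, scaleCoeff_scaleCoeff]
        rw [inv_mul_cancel₀ (ne_of_gt q.1.2), scaleCoeff_one]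
      continuous_toFun := by
        have h1 : Continuous fun a : F => s * ρ a := hρc.const_mul s
        have h2 := h1.inv₀ fun a => (hpos a).ne'
        exact (h1.subtype_mk hpos).prodMk
          ((continuous_scaleCoeff.comp (h2.prodMk continuous_subtype_val)).subtype_mk hnorm)
      continuous_invFun := by
        refine Continuous.subtype_mk ?_ hmem
        exact continuous_scaleCoeff.comp
          ((continuous_subtype_val.comp continuous_fst).prodMk
            (continuous_subtype_val.comp continuous_snd)) }
  obtain ⟨a, ha⟩ := exists_coeff_isSimpleCrossing hd ε hε
  have : ContractibleSpace K := (convex_isSimpleCrossing ε s).contractibleSpace ⟨_, hnorm ⟨a, ha⟩⟩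
  have : ContractibleSpace (Set.Ioi (0 : ℝ)) :=
    (convex_Ioi (0 : ℝ)).contractibleSpace ⟨1, Set.mem_Ioi.2 one_pos⟩
  exact e.contractibleSpace

theorem stmt1 (d : ℕ) (hd : Odd d)
    (ε : Fin d → ℝ) (hε : ∀ j, ε j = 1 ∨ ε j = -1) :
    let F : Set (Fin d → ℝ) :=
      {a | (∀ j : Fin d, 0 < ε j * a j) ∧
        ∃ r : ℝ, (Qpoly d a).eval r = 0 ∧
          (Polynomial.derivative (Qpoly d a)).eval r ≠ 0 ∧
          ∀ x : ℝ, (Qpoly d a).eval x = 0 → x = r}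
    F.Nonempty ∧ ContractibleSpace F := by
  intro F
  have hF : F = {a | (∀ j, 0 < ε j * a j) ∧ ∃ r, IsSimpleCrossing (Qpoly d a) r} := by
    ext a
    refine and_congr_right fun _ => exists_congr fun r => ⟨fun h => ?_, fun h => ?_⟩
    · exact isSimpleCrossing_of_unique_root hd a h.1 h.2.1 h.2.2
    · exact ⟨h.root, h.derivative_pos.ne', fun x => h.eq_of_root⟩
  rw [hF]
  exact ⟨exists_coeff_isSimpleCrossing hd ε hε, contractibleSpace_isSimpleCrossing hd ε hε⟩
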